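/- Let (Ω, μ) be a probability space, H a real Hilbert space, θ, θ* ∈ H, and v : Ω → H with v Bochner integrable and ‖v‖² integrable. Let g : Ω → ℝ be integrable with ∫_Ω g dμ ≥ 0, let L, M ≥ 0, H_c > 0, and 0 < η ≤ 1/(2L + M). Suppose: (i) ⟨θ − θ*, ∫_Ω v dμ⟩ ≥ ∫_Ω g dμ; (ii) ∫_Ω ‖v‖² dμ ≤ (4L + 2M) ∫_Ω g dμ; (iii) ∫_Ω g dμ ≥ (H_c/2) ‖θ − θ*‖². Then, with θ'(ω) = θ − η v(ω), ∫_Ω ‖θ'(ω) − θ*‖² dμ(ω) ≤ (1 − η H_c (1 − η(2L + M))) ‖θ − θ*‖². -/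

import Mathlib

open RealInnerProductSpace MeasureTheory

/-- Expansion of the mean squared distance after a random step `-η • v`. -/
theorem integral_norm_sub_smul_sq {Ω : Type*} [MeasurableSpace Ω] {μ : Measure Ω}
    [IsProbabilityMeasure μ] {H : Type*} [NormedAddCommGroup H] [InnerProductSpace ℝ H]
    [CompleteSpace H] (x : H) {v : Ω → H} (hv : Integrable v μ)
    (hv2 : Integrable (fun ω => ‖v ω‖ ^ 2) μ) (η : ℝ) :
    ∫ ω, ‖x - η • v ω‖ ^ 2 ∂μ =
      ‖x‖ ^ 2 - 2 * η * ⟪x, ∫ ω, v ω ∂μ⟫ + η ^ 2 * ∫ ω, ‖v ω‖ ^ 2 ∂μ := by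
  have expand (ω : Ω) : ‖x - η • v ω‖ ^ 2 =
      ‖x‖ ^ 2 - 2 * η * ⟪x, v ω⟫ + η ^ 2 * ‖v ω‖ ^ 2 := by
    rw [norm_sub_sq_real, inner_smul_right, norm_smul, mul_pow, Real.norm_eq_abs, sq_abs]
    ring
  have hinner : Integrable (fun ω => 2 * η * ⟪x, v ω⟫) μ := (hv.const_inner x).const_mul _
  simp_rw [expand]
  rw [integral_add (by fun_prop) (by fun_prop),
    integral_sub (integrable_const _) hinner, integral_const_mul, integral_const_mul,
    integral_inner hv]
  simp

/-- One-step contraction: under alignment, second-moment, and strong-convexity-gap bounds,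
the update `θ' = θ - η v` with `0 < η ≤ 1/(2L + M)` satisfies
`∫ ‖θ' - θ*‖² ≤ (1 - η H_c (1 - η(2L + M))) ‖θ - θ*‖²`. -/
theorem stmt_8 {Ω : Type*} [MeasurableSpace Ω] (μ : Measure Ω) [IsProbabilityMeasure μ]
    {H : Type*} [NormedAddCommGroup H] [InnerProductSpace ℝ H] [CompleteSpace H]
    (θ θstar : H) (v : Ω → H)
    (hv : Integrable v μ)
    (hv2 : Integrable (fun ω => ‖v ω‖ ^ 2) μ)
    (g : Ω → ℝ) (hg : Integrable g μ) (hg0 : 0 ≤ ∫ ω, g ω ∂μ)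
    (L M Hc η : ℝ) (hL : 0 ≤ L) (hM : 0 ≤ M) (hHc : 0 < Hc)
    (hη0 : 0 < η) (hη : η ≤ 1 / (2 * L + M))
    (hi : ⟪θ - θstar, ∫ ω, v ω ∂μ⟫ ≥ ∫ ω, g ω ∂μ)
    (hii : ∫ ω, ‖v ω‖ ^ 2 ∂μ ≤ (4 * L + 2 * M) * ∫ ω, g ω ∂μ)
    (hiii : ∫ ω, g ω ∂μ ≥ Hc / 2 * ‖θ - θstar‖ ^ 2) :
    ∫ ω, ‖(θ - η • v ω) - θstar‖ ^ 2 ∂μ ≤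
      (1 - η * Hc * (1 - η * (2 * L + M))) * ‖θ - θstar‖ ^ 2 := by
  have hstep : η * (2 * L + M) ≤ 1 :=
    (mul_le_mul_of_nonneg_right hη (by positivity)).trans
      (by rw [one_div_mul_eq_div]; exact div_self_le_one _)
  have hshift (ω : Ω) : θ - η • v ω - θstar = θ - θstar - η • v ω := sub_right_comm _ _ _
  simp_rw [hshift]
  rw [integral_norm_sub_smul_sq _ hv hv2]
  have h₁ := mul_le_mul_of_nonneg_left hi (by positivity : 0 ≤ 2 * η)
  have h₂ := mul_le_mul_of_nonneg_left hii (sq_nonneg η)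
  have h₃ := mul_le_mul_of_nonneg_left hiii
    (mul_nonneg (by positivity : 0 ≤ 2 * η) (sub_nonneg.2 hstep))
  linarith
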